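/- The Toda-type equation (T₁) holds: for every n ≥ 0 and t < 0, t·(d/dt)α_n(t) = α_n(t) + r_n(t) − r_{n+1}(t). -/

import Mathlib

open MeasureTheory Real

/-- The generalized Jacobi weight `w(x;t) = (x-t)^γ x^α (1-x)^β`. -/
noncomputable def genJacobiWeight (α β γ t x : ℝ) : ℝ :=
  (x - t) ^ γ * x ^ α * (1 - x) ^ β

section Weight

open Polynomial Set

variable {α β t : ℝ}

lemma continuousOn_uncurry_genJacobiWeight (γ : ℝ) (hα : 0 < α) (hβ : 0 < β) :
    ContinuousOn (fun z : ℝ × ℝ => genJacobiWeight α β γ z.1 z.2) (Iio 0 ×ˢ Icc 0 1) := by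
  unfold genJacobiWeight
  refine ((ContinuousOn.rpow_const (by fun_prop) ?_).mul
    (ContinuousOn.rpow_const (by fun_prop) fun _ _ => Or.inr hα.le)).mul
    (ContinuousOn.rpow_const (by fun_prop) fun _ _ => Or.inr hβ.le)
  rintro ⟨s, x⟩ ⟨hs, hx⟩
  simp only [mem_Iio, mem_Icc] at hs hx
  exact Or.inl (by simp only; linarith [hx.1])

lemma continuousOn_genJacobiWeight (γ : ℝ) (hα : 0 < α) (hβ : 0 < β) (ht : t < 0) :
    ContinuousOn (genJacobiWeight α β γ t) (Icc 0 1) :=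
  (continuousOn_uncurry_genJacobiWeight γ hα hβ).comp
    (f := fun x : ℝ => (t, x)) (by fun_prop) fun _ hx => ⟨ht, hx⟩

lemma intervalIntegrable_eval_mul_genJacobiWeight (γ : ℝ) (hα : 0 < α) (hβ : 0 < β) (ht : t < 0)
    (p : ℝ[X]) :
    IntervalIntegrable (fun x => p.eval x * genJacobiWeight α β γ t x) volume 0 1 := by
  apply ContinuousOn.intervalIntegrable
  rw [uIcc_of_le zero_le_one]
  exact p.continuous.continuousOn.mul (continuousOn_genJacobiWeight γ hα hβ ht)

lemma intervalIntegrable_eval_mul_genJacobiWeight_div (γ : ℝ) (hα : 0 < α) (hβ : 0 < β)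
    (ht : t < 0) (p : ℝ[X]) :
    IntervalIntegrable (fun x => p.eval x * genJacobiWeight α β γ t x / (1 - x)) volume 0 1 := by
  have hpow : IntervalIntegrable (fun x : ℝ => (1 - x) ^ (β - 1)) volume 0 1 := by
    have := (intervalIntegral.intervalIntegrable_rpow' (a := 0) (b := 1) (r := β - 1)
      (by linarith)).comp_sub_left 1
    simpa using this.symm
  have hcont : ContinuousOn (fun x => p.eval x * ((x - t) ^ γ * x ^ α)) (uIcc 0 1) := by
    rw [uIcc_of_le zero_le_one]
    refine p.continuous.continuousOn.mul ((ContinuousOn.rpow_const (by fun_prop) ?_).mul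
      (ContinuousOn.rpow_const (by fun_prop) fun _ _ => Or.inr hα.le))
    intro x hx
    exact Or.inl (by linarith [hx.1])
  refine (hpow.continuousOn_mul hcont).congr_uIoo ?_
  intro x hx
  rw [uIoo_of_le zero_le_one] at hx
  have hx1 : 0 < 1 - x := sub_pos.2 hx.2
  simp only [genJacobiWeight, rpow_sub_one hx1.ne']
  ring

/-- Differentiation under the integral sign in the parameter of the weight. -/
lemma hasDerivAt_integral_eval_mul_genJacobiWeight (γ : ℝ) (hα : 0 < α) (hβ : 0 < β) (ht : t < 0)
    (p : ℝ[X]) :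
    HasDerivAt (fun s => ∫ x in (0 : ℝ)..1, p.eval x * genJacobiWeight α β γ s x)
      (∫ x in (0 : ℝ)..1, p.eval x * (-γ * genJacobiWeight α β (γ - 1) t x)) t := by
  have hcont : ContinuousOn (fun z : ℝ × ℝ =>
      p.eval z.2 * (-γ * genJacobiWeight α β (γ - 1) z.1 z.2)) (Iio 0 ×ˢ Icc 0 1) :=
    (p.continuous.comp continuous_snd).continuousOn.mul
      (continuousOn_const.mul (continuousOn_uncurry_genJacobiWeight (γ - 1) hα hβ))
  have hsub : Icc (2 * t) (t / 2) ⊆ Iio 0 := fun s hs => by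
    simp only [mem_Icc, mem_Iio] at hs ⊢; linarith
  obtain ⟨C, hC⟩ := (isCompact_Icc.prod isCompact_Icc).exists_bound_of_continuousOn
    (hcont.mono (prod_mono hsub subset_rfl))
  have hnhds : Icc (2 * t) (t / 2) ∈ nhds t := Icc_mem_nhds (by linarith) (by linarith)
  refine (intervalIntegral.hasDerivAt_integral_of_dominated_loc_of_deriv_le
    (F' := fun s x => p.eval x * (-γ * genJacobiWeight α β (γ - 1) s x))
    (bound := fun _ => C) hnhds ?_
    (intervalIntegrable_eval_mul_genJacobiWeight γ hα hβ ht p) ?_ ?_ (by simp) ?_).2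
  · filter_upwards [Iio_mem_nhds ht] with s hs
    exact (intervalIntegrable_eval_mul_genJacobiWeight γ hα hβ hs p).def'.aestronglyMeasurable
  · have := (intervalIntegrable_eval_mul_genJacobiWeight (γ - 1) hα hβ ht
      (Polynomial.C (-γ) * p)).def'.aestronglyMeasurable
    refine this.congr (.of_forall fun x => ?_)
    simp only [eval_mul, eval_C]
    ring
  · refine .of_forall fun x hx s hs => hC (s, x) ⟨hs, ?_⟩
    rw [uIoc_of_le zero_le_one] at hx
    exact Ioc_subset_Icc_self hx
  · refine .of_forall fun x hx s hs => ?_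
    rw [uIoc_of_le zero_le_one] at hx
    have hpos : x - s ≠ 0 := by have := hsub hs; simp only [mem_Iio] at this; linarith [hx.1]
    have := ((((hasDerivAt_id s).const_sub x).rpow_const (p := γ) (Or.inl hpos)).mul_const
      (x ^ α * (1 - x) ^ β)).const_mul (p.eval x)
    refine (this.congr_deriv ?_).congr_of_eventuallyEq (.of_forall fun u => ?_)
    · simp only [genJacobiWeight, id]; ring
    · simp only [genJacobiWeight, id]; ring

/-- The `t`-derivative of a moment functional in terms of the functional itself, obtained by
integrating `d/dx (x p(x) w(x;t))` over `[0,1]`. -/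
lemma mul_integral_deriv_genJacobiWeight (γ : ℝ) (hα : 0 < α) (hβ : 0 < β) (ht : t < 0)
    (p : ℝ[X]) :
    t * (∫ x in (0 : ℝ)..1, p.eval x * (-γ * genJacobiWeight α β (γ - 1) t x)) =
      (1 + α + β + γ) * (∫ x in (0 : ℝ)..1, p.eval x * genJacobiWeight α β γ t x)
      + (∫ x in (0 : ℝ)..1, (X * derivative p).eval x * genJacobiWeight α β γ t x)
      - β * ∫ x in (0 : ℝ)..1, p.eval x * genJacobiWeight α β γ t x / (1 - x) := by
  have i₁ := (intervalIntegrable_eval_mul_genJacobiWeight γ hα hβ ht p).const_mul (1 + α + β + γ)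
  have i₂ := intervalIntegrable_eval_mul_genJacobiWeight γ hα hβ ht (X * derivative p)
  have i₃ : IntervalIntegrable
      (fun x => t * (p.eval x * (-γ * genJacobiWeight α β (γ - 1) t x))) volume 0 1 := by
    refine (intervalIntegrable_eval_mul_genJacobiWeight (γ - 1) hα hβ ht
      (C (t * -γ) * p)).congr fun x _ => ?_
    simp only [eval_mul, eval_C]
    ring
  have i₄ := (intervalIntegrable_eval_mul_genJacobiWeight_div γ hα hβ ht p).const_mul β
  have key := intervalIntegral.integral_eq_sub_of_hasDerivAt_of_le zero_le_one
    (f := fun x => x * (p.eval x * genJacobiWeight α β γ t x)) ?_ ?_ (((i₁.add i₂).sub i₃).sub i₄)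
  · rw [intervalIntegral.integral_sub ((i₁.add i₂).sub i₃) i₄,
      intervalIntegral.integral_sub (i₁.add i₂) i₃, intervalIntegral.integral_add i₁ i₂] at key
    simp only [intervalIntegral.integral_const_mul] at key
    have h1 : genJacobiWeight α β γ t 1 = 0 := by simp [genJacobiWeight, zero_rpow hβ.ne']
    rw [h1] at key
    linarith
  · exact continuousOn_id.mul
      (p.continuous.continuousOn.mul (continuousOn_genJacobiWeight γ hα hβ ht))
  · intro x hx
    have hx0 : x ≠ 0 := hx.1.ne'
    have hx1 : 1 - x ≠ 0 := (sub_pos.2 hx.2).ne'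
    have hxt : x - t ≠ 0 := by linarith [hx.1]
    have hw := ((((hasDerivAt_id x).sub_const t).rpow_const (p := γ) (Or.inl hxt)).mul
      ((hasDerivAt_id x).rpow_const (p := α) (Or.inl hx0))).mul
      (((hasDerivAt_id x).const_sub 1).rpow_const (p := β) (Or.inl hx1))
    refine ((hasDerivAt_id x).mul ((p.hasDerivAt x).mul hw)).congr_deriv ?_
    simp only [genJacobiWeight, id, eval_mul, eval_X, Pi.mul_apply, rpow_sub_one hx0, rpow_sub_one hx1,
      rpow_sub_one hxt]
    field_simp
    ring

/-- For `t < 0`, integration against the weight is a linear functional on polynomials. -/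
lemma exists_genJacobi_functional (γ : ℝ) (hα : 0 < α) (hβ : 0 < β) :
    ∃ L : ℝ → ℝ[X] →ₗ[ℝ] ℝ, ∀ s < 0, ∀ p,
      L s p = ∫ x in (0 : ℝ)..1, p.eval x * genJacobiWeight α β γ s x := by
  have : ∀ s : ℝ, ∃ l : ℝ[X] →ₗ[ℝ] ℝ, s < 0 → ∀ p,
      l p = ∫ x in (0 : ℝ)..1, p.eval x * genJacobiWeight α β γ s x := by
    intro s
    by_cases hs : s < 0
    · refine ⟨⟨⟨fun p => ∫ x in (0 : ℝ)..1, p.eval x * genJacobiWeight α β γ s x, ?_⟩, ?_⟩,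
        fun _ _ => rfl⟩
      · intro p q
        rw [← intervalIntegral.integral_add
          (intervalIntegrable_eval_mul_genJacobiWeight γ hα hβ hs p)
          (intervalIntegrable_eval_mul_genJacobiWeight γ hα hβ hs q)]
        simp only [eval_add, add_mul]
      · intro c p
        simp only [eval_smul, smul_eq_mul, mul_assoc, intervalIntegral.integral_const_mul,
          RingHom.id_apply]
    · exact ⟨0, fun h => absurd h hs⟩
  choose L hL using this
  exact ⟨L, hL⟩

end Weight

section CoefficientFamilies

open Polynomial

variable {p q : ℝ → ℝ[X]} {t : ℝ} {L : ℝ → ℝ[X] →ₗ[ℝ] ℝ}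

lemma differentiableAt_coeff_mul (hp : ∀ k, DifferentiableAt ℝ (fun s => (p s).coeff k) t)
    (hq : ∀ k, DifferentiableAt ℝ (fun s => (q s).coeff k) t) (k : ℕ) :
    DifferentiableAt ℝ (fun s => (p s * q s).coeff k) t := by
  simp only [coeff_mul]
  exact DifferentiableAt.fun_sum fun x _ => (hp x.1).mul (hq x.2)

lemma LinearMap.eq_sum_coeff_mul_X_pow (l : ℝ[X] →ₗ[ℝ] ℝ) (p : ℝ[X]) {N : ℕ}
    (hN : p.natDegree < N) : l p = ∑ k ∈ Finset.range N, p.coeff k * l (X ^ k) := by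
  conv_lhs => rw [p.as_sum_range' N hN]
  simp only [map_sum, ← smul_X_eq_monomial, map_smul, smul_eq_mul]

lemma differentiableAt_functional_apply {N : ℕ}
    (hp : ∀ k, DifferentiableAt ℝ (fun s => (p s).coeff k) t)
    (hN : ∀ᶠ s in nhds t, (p s).natDegree < N)
    (hL : ∀ q, DifferentiableAt ℝ (fun s => L s q) t) :
    DifferentiableAt ℝ (fun s => L s (p s)) t := by
  have : DifferentiableAt ℝ (fun s => ∑ k ∈ Finset.range N, (p s).coeff k * L s (X ^ k)) t :=
    DifferentiableAt.fun_sum fun k _ => (hp k).mul (hL _)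
  refine this.congr_of_eventuallyEq ?_
  filter_upwards [hN] with s hs using (L s).eq_sum_coeff_mul_X_pow _ hs

/-- If the coefficients of `p s` are differentiable at `t`, then the variation of the functional
along `p` is, to first order, its variation along the fixed polynomial `p t`. -/
lemma hasDerivAt_functional_apply_sub {N : ℕ} {D : ℝ[X] → ℝ}
    (hp : ∀ k, DifferentiableAt ℝ (fun s => (p s).coeff k) t)
    (hN : ∀ᶠ s in nhds t, (p s).natDegree < N)
    (hL : ∀ q, HasDerivAt (fun s => L s q) (D q) t) :
    HasDerivAt (fun s => L s (p s) - L t (p s)) (D (p t)) t := by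
  have hsum : HasDerivAt
      (fun s => ∑ k ∈ Finset.range N, (p s).coeff k * (L s (X ^ k) - L t (X ^ k)))
      (∑ k ∈ Finset.range N, (p t).coeff k * D (X ^ k)) t := by
    refine HasDerivAt.fun_sum fun k _ => ?_
    refine ((hp k).hasDerivAt.mul ((hL (X ^ k)).sub_const _)).congr_deriv ?_
    simp
  have hfix : HasDerivAt (fun s => L s (p t))
      (∑ k ∈ Finset.range N, (p t).coeff k * D (X ^ k)) t := by
    have : HasDerivAt (fun s => ∑ k ∈ Finset.range N, (p t).coeff k * L s (X ^ k))
        (∑ k ∈ Finset.range N, (p t).coeff k * D (X ^ k)) t :=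
      HasDerivAt.fun_sum fun k _ => (hL (X ^ k)).const_mul _
    refine this.congr_of_eventuallyEq (.of_forall fun s => ?_)
    exact (L s).eq_sum_coeff_mul_X_pow _ hN.self_of_nhds
  rw [(hL (p t)).unique hfix]
  refine hsum.congr_of_eventuallyEq ?_
  filter_upwards [hN] with s hs
  rw [(L s).eq_sum_coeff_mul_X_pow _ hs, (L t).eq_sum_coeff_mul_X_pow _ hs,
    ← Finset.sum_sub_distrib]
  exact Finset.sum_congr rfl fun k _ => by ring

end CoefficientFamilies

section OrthogonalPolynomials

open Polynomial

variable {l : ℝ[X] →ₗ[ℝ] ℝ} {P : ℕ → ℝ[X]} {h : ℕ → ℝ}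

lemma coeff_eq_one_of_monic {p : ℝ[X]} {n : ℕ} (hp : p.Monic ∧ p.natDegree = n) :
    p.coeff n = 1 :=
  hp.2 ▸ hp.1.coeff_natDegree

lemma functional_mul_eq_zero_of_degree_lt (hmonic : ∀ n, (P n).Monic ∧ (P n).natDegree = n)
    (horth : ∀ m n, l (P m * P n) = if m = n then h n else 0) {n : ℕ} {k : ℕ} (hk : k ≤ n) :
    ∀ q : ℝ[X], q.degree < k → l (q * P n) = 0 := by
  induction k with
  | zero =>
    intro q hq
    rw [Nat.cast_zero, Nat.WithBot.lt_zero_iff, degree_eq_bot] at hq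
    simp [hq]
  | succ k ih =>
    intro q hq
    have hlow : (q - C (q.coeff k) * P k).degree < k := by
      rw [degree_lt_iff_coeff_zero]
      intro m hm
      rw [coeff_sub, coeff_C_mul]
      rcases hm.eq_or_lt with rfl | hm
      · simp [coeff_eq_one_of_monic (hmonic k)]
      · rw [coeff_eq_zero_of_degree_lt (hq.trans_le (by exact_mod_cast hm)),
          coeff_eq_zero_of_natDegree_lt ((hmonic k).2.trans_lt hm)]
        simp
    have hsplit : q * P n = (q - C (q.coeff k) * P k) * P n + q.coeff k • (P k * P n) := by
      rw [smul_eq_C_mul]; ring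
    rw [hsplit, map_add, ih (by omega) _ hlow, map_smul, horth, if_neg (by omega)]
    simp

lemma functional_mul_eq_coeff_mul (hmonic : ∀ n, (P n).Monic ∧ (P n).natDegree = n)
    (horth : ∀ m n, l (P m * P n) = if m = n then h n else 0) {n : ℕ} {q : ℝ[X]}
    (hq : q.natDegree ≤ n) : l (q * P n) = q.coeff n * h n := by
  have hlow : (q - C (q.coeff n) * P n).degree < n := by
    rw [degree_lt_iff_coeff_zero]
    intro m hm
    rw [coeff_sub, coeff_C_mul]
    rcases hm.eq_or_lt with rfl | hm
    · simp [coeff_eq_one_of_monic (hmonic n)]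
    · rw [coeff_eq_zero_of_natDegree_lt (hq.trans_lt hm),
        coeff_eq_zero_of_natDegree_lt ((hmonic n).2.trans_lt hm)]
      simp
  have hsplit : q * P n = (q - C (q.coeff n) * P n) * P n + q.coeff n • (P n * P n) := by
    rw [smul_eq_C_mul]; ring
  rw [hsplit, map_add, functional_mul_eq_zero_of_degree_lt hmonic horth le_rfl _ hlow, map_smul,
    horth, if_pos rfl]
  simp

/-- `⟨X (P_{n+1} P_n)'⟩ = - p₁ h_n`, with `p₁` the subleading coefficient of `P_{n+1}`. -/
lemma functional_X_mul_derivative_mul (hmonic : ∀ n, (P n).Monic ∧ (P n).natDegree = n)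
    (horth : ∀ m n, l (P m * P n) = if m = n then h n else 0) (n : ℕ) :
    l (X * derivative (P (n + 1) * P n)) = -((P (n + 1)).coeff n * h n) := by
  have hcoeff : ∀ (p : ℝ[X]) (k : ℕ), (X * derivative p).coeff k = k * p.coeff k := by
    rintro p (_ | k)
    · simp
    · rw [coeff_X_mul, coeff_derivative]; push_cast; ring
  have hlow : (X * derivative (P n)).degree < ((n + 1 : ℕ) : WithBot ℕ) := by
    rw [degree_lt_iff_coeff_zero]
    intro m hm
    rw [hcoeff, coeff_eq_zero_of_natDegree_lt ((hmonic n).2.trans_lt hm), mul_zero]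
  have hdeg : (X * derivative (P (n + 1)) - C (n + 1 : ℝ) * P (n + 1)).natDegree ≤ n := by
    rw [natDegree_le_iff_coeff_eq_zero]
    intro m hm
    rw [coeff_sub, coeff_C_mul, hcoeff]
    rcases (Nat.succ_le_of_lt hm).eq_or_lt with rfl | hm
    · push_cast; ring
    · rw [coeff_eq_zero_of_natDegree_lt ((hmonic (n + 1)).2.trans_lt hm)]
      simp
  have hsplit : X * derivative (P (n + 1) * P n) =
      (X * derivative (P (n + 1)) - C (n + 1 : ℝ) * P (n + 1)) * P n
        + (n + 1 : ℝ) • (P (n + 1) * P n) + X * derivative (P n) * P (n + 1) := by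
    rw [smul_eq_C_mul, derivative_mul]; ring
  rw [hsplit, map_add, map_add, functional_mul_eq_coeff_mul hmonic horth hdeg, map_smul, horth,
    functional_mul_eq_zero_of_degree_lt hmonic horth le_rfl _ hlow, if_neg (by omega), coeff_sub,
    coeff_C_mul, hcoeff]
  simp only [smul_eq_mul]
  ring

end OrthogonalPolynomials

section OrthogonalFamilies

open Polynomial

variable {L : ℝ → ℝ[X] →ₗ[ℝ] ℝ} {P : ℝ → ℕ → ℝ[X]} {h a b : ℝ → ℕ → ℝ} {t : ℝ} {D : ℝ[X] → ℝ}
  {n : ℕ}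

/-- The coefficients of monic orthogonal polynomials depend differentiably on a parameter as soon
as the functional does. -/
lemma differentiableAt_coeff_of_orthogonal
    (hmonic : ∀ᶠ s in nhds t, ∀ n, (P s n).Monic ∧ (P s n).natDegree = n)
    (hne : ∀ᶠ s in nhds t, ∀ n, h s n ≠ 0)
    (horth : ∀ᶠ s in nhds t, ∀ m n, L s (P s m * P s n) = if m = n then h s n else 0)
    (hb0 : ∀ᶠ s in nhds t, b s 0 = 0)
    (hrec : ∀ᶠ s in nhds t, ∀ n, X * P s n = P s (n + 1) + a s n • P s n + b s n • P s (n - 1))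
    (hL : ∀ q, DifferentiableAt ℝ (fun s => L s q) t) (n : ℕ) :
    ∀ k, DifferentiableAt ℝ (fun s => (P s n).coeff k) t := by
  induction n using Nat.strong_induction_on with
  | _ n ih =>
  rcases n with _ | n
  · intro k
    refine (differentiableAt_const ((1 : ℝ[X]).coeff k)).congr_of_eventuallyEq ?_
    filter_upwards [hmonic] with s hs
    rw [(hs 0).1.natDegree_eq_zero.1 (hs 0).2]
  have hX : ∀ m < n + 1, ∀ k, DifferentiableAt ℝ (fun s => (X * P s m).coeff k) t := by
    rintro m hm (_ | k)
    · simp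
    · simpa only [coeff_X_mul] using ih m hm k
  have hh : ∀ m < n + 1, DifferentiableAt ℝ (fun s => h s m) t := by
    intro m hm
    have : DifferentiableAt ℝ (fun s => L s (P s m * P s m)) t := by
      refine differentiableAt_functional_apply (N := m + m + 1)
        (differentiableAt_coeff_mul (ih m hm) (ih m hm)) ?_ hL
      filter_upwards [hmonic] with s hs
      rw [(hs m).1.natDegree_mul (hs m).1, (hs m).2]
      omega
    refine this.congr_of_eventuallyEq ?_
    filter_upwards [horth] with s hs
    simp [hs]
  have hXL : ∀ m < n + 1, DifferentiableAt ℝ (fun s => L s (X * P s n * P s m)) t := by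
    intro m hm
    refine differentiableAt_functional_apply (N := 1 + n + m + 1)
      (differentiableAt_coeff_mul (hX n (by omega)) (ih m hm)) ?_ hL
    filter_upwards [hmonic] with s hs
    rw [(monic_X.mul (hs n).1).natDegree_mul (hs m).1, monic_X.natDegree_mul (hs n).1, (hs m).2,
      (hs n).2, natDegree_X]
    omega
  have ha : DifferentiableAt ℝ (fun s => a s n) t := by
    refine ((hXL n (by omega)).div (hh n (by omega))
      (hne.self_of_nhds n)).congr_of_eventuallyEq ?_
    filter_upwards [horth, hne, hb0, hrec] with s ho hne hb0 hrec
    rw [Pi.div_apply, eq_div_iff (hne n), hrec, add_mul, add_mul, smul_mul_assoc, smul_mul_assoc,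
      map_add, map_add, map_smul, map_smul, ho, ho, ho, if_neg (by omega), if_pos rfl]
    rcases n with _ | n
    · simp [hb0]
    · simp
  have hb : DifferentiableAt ℝ (fun s => b s n) t := by
    rcases n with _ | n
    · exact (differentiableAt_const (0 : ℝ)).congr_of_eventuallyEq hb0
    refine ((hXL n (by omega)).div (hh n (by omega))
      (hne.self_of_nhds n)).congr_of_eventuallyEq ?_
    filter_upwards [horth, hne, hrec] with s ho hne hrec
    rw [Pi.div_apply, eq_div_iff (hne n), hrec, add_mul, add_mul, smul_mul_assoc, smul_mul_assoc,
      map_add, map_add, map_smul, map_smul, ho, ho, ho, if_neg (by omega), if_neg (by omega),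
      if_pos (by omega)]
    simp
  intro k
  refine (((hX n (by omega) k).sub (ha.mul (ih n (by omega) k))).sub
    (hb.mul (ih (n - 1) (by omega) k))).congr_of_eventuallyEq ?_
  filter_upwards [hrec] with s hs
  have := congrArg (fun q => coeff q k) (hs n)
  simp only [coeff_add, coeff_smul, smul_eq_mul] at this
  simp only [Pi.sub_apply, Pi.mul_apply, this]
  ring

/-- The derivative of the subleading coefficient of `P_{n+1}` is governed by the derivative of the
functional at `P_{n+1} P_n`. -/
lemma hasDerivAt_subleading_coeff
    (hmonic : ∀ᶠ s in nhds t, ∀ n, (P s n).Monic ∧ (P s n).natDegree = n)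
    (hne : h t n ≠ 0)
    (horth : ∀ᶠ s in nhds t, ∀ m n, L s (P s m * P s n) = if m = n then h s n else 0)
    (hL : ∀ q, HasDerivAt (fun s => L s q) (D q) t)
    (hP : ∀ k, DifferentiableAt ℝ (fun s => (P s (n + 1)).coeff k) t) :
    HasDerivAt (fun s => (P s (n + 1)).coeff n) (-(D (P t (n + 1) * P t n) / h t n)) t := by
  have hmt := hmonic.self_of_nhds
  have hvar := hasDerivAt_functional_apply_sub (p := fun s => P s (n + 1) * P t n)
    (N := n + 1 + n + 1) (differentiableAt_coeff_mul hP fun k => differentiableAt_const _)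
    (by
      filter_upwards [hmonic] with s hs
      rw [(hs (n + 1)).1.natDegree_mul (hmt n).1, (hs (n + 1)).2, (hmt n).2]
      omega) hL
  refine (((hvar.div_const (h t n)).neg).add_const
    ((P t (n + 1)).coeff n)).congr_of_eventuallyEq ?_
  filter_upwards [hmonic, horth] with s hm ho
  have hzero : L s (P s (n + 1) * P t n) = 0 := by
    rw [mul_comm]
    refine functional_mul_eq_zero_of_degree_lt hm ho le_rfl _ ?_
    rw [degree_eq_natDegree (hmt n).1.ne_zero, (hmt n).2]
    exact_mod_cast n.lt_succ_self
  have hdeg : (P s (n + 1) - P t (n + 1)).natDegree ≤ n := by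
    rw [natDegree_le_iff_coeff_eq_zero]
    intro m hmn
    rw [coeff_sub]
    rcases (Nat.succ_le_of_lt hmn).eq_or_lt with rfl | hmn
    · rw [Nat.succ_eq_add_one, coeff_eq_one_of_monic (hm (n + 1)),
        coeff_eq_one_of_monic (hmt (n + 1)), sub_self]
    · rw [coeff_eq_zero_of_natDegree_lt ((hm (n + 1)).2.trans_lt hmn),
        coeff_eq_zero_of_natDegree_lt ((hmt (n + 1)).2.trans_lt hmn), sub_self]
  have hdiff : L t (P s (n + 1) * P t n)
      = ((P s (n + 1)).coeff n - (P t (n + 1)).coeff n) * h t n := by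
    have := functional_mul_eq_coeff_mul hmt horth.self_of_nhds hdeg
    rwa [sub_mul, map_sub, horth.self_of_nhds, if_neg (by omega), sub_zero, coeff_sub] at this
  simp only [hzero, hdiff, Pi.neg_apply]
  field_simp
  ring

end OrthogonalFamilies

theorem statement17
    (α β γ : ℝ) (hα : 0 < α) (hβ : 0 < β)
    (P : ℝ → ℕ → Polynomial ℝ) (h : ℝ → ℕ → ℝ)
    (hmonic : ∀ t < (0:ℝ), ∀ n, (P t n).Monic ∧ (P t n).natDegree = n)
    (hpos : ∀ t < (0:ℝ), ∀ n, 0 < h t n)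
    (horth : ∀ t < (0:ℝ), ∀ m n, (∫ x in (0:ℝ)..1,
        (P t m).eval x * (P t n).eval x * genJacobiWeight α β γ t x)
      = if m = n then h t n else 0)
    (a b : ℝ → ℕ → ℝ) (hb0 : ∀ t < (0:ℝ), b t 0 = 0)
    (hrec : ∀ t < (0:ℝ), ∀ n, ∀ x : ℝ, x * (P t n).eval x
      = (P t (n + 1)).eval x + a t n * (P t n).eval x + b t n * (P t (n - 1)).eval x)
    (r : ℝ → ℕ → ℝ) (hr0 : ∀ t < (0:ℝ), r t 0 = 0)
    (hr : ∀ t < (0:ℝ), ∀ n, 1 ≤ n → r t n = β / h t (n - 1) *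
      ∫ y in (0:ℝ)..1, (P t (n - 1)).eval y * (P t n).eval y
        * genJacobiWeight α β γ t y / (1 - y)) :
    ∀ n : ℕ, ∀ t < (0:ℝ),
      t * deriv (fun s => a s n) t = a t n + r t n - r t (n + 1) := by
  intro n t ht
  obtain ⟨L, hLint⟩ := exists_genJacobi_functional γ hα hβ
  have hneg : ∀ᶠ s in nhds t, s < 0 := Iio_mem_nhds ht
  have hLorth : ∀ s < 0, ∀ m n, L s (P s m * P s n) = if m = n then h s n else 0 := by
    intro s hs m n
    simp only [hLint s hs, Polynomial.eval_mul, horth s hs]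
  have hrecP : ∀ s < 0, ∀ n, Polynomial.X * P s n
      = P s (n + 1) + a s n • P s n + b s n • P s (n - 1) := by
    intro s hs n
    refine Polynomial.funext fun x => ?_
    simpa using hrec s hs n x
  have hLderiv : ∀ q, HasDerivAt (fun s => L s q)
      (∫ x in (0 : ℝ)..1, q.eval x * (-γ * genJacobiWeight α β (γ - 1) t x)) t := by
    intro q
    refine (hasDerivAt_integral_eval_mul_genJacobiWeight γ hα hβ ht q).congr_of_eventuallyEq ?_
    filter_upwards [hneg] with s hs using hLint s hs q
  have hcoeff := differentiableAt_coeff_of_orthogonal (hneg.mono hmonic)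
    (hneg.mono fun s hs n => (hpos s hs n).ne') (hneg.mono hLorth) (hneg.mono hb0)
    (hneg.mono hrecP) fun q => (hLderiv q).differentiableAt
  have hsub : ∀ n, ∃ d, HasDerivAt (fun s => (Polynomial.X * P s n).coeff n) d t ∧
      t * d = (Polynomial.X * P t n).coeff n + r t n := by
    rintro (_ | m)
    · exact ⟨0, by simpa using hasDerivAt_const t (0 : ℝ), by simp [hr0 t ht]⟩
    simp only [Polynomial.coeff_X_mul]
    have hne : h t m ≠ 0 := (hpos t ht m).ne'
    refine ⟨_, hasDerivAt_subleading_coeff (hneg.mono hmonic) hne (hneg.mono hLorth) hLderiv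
      (hcoeff (m + 1)), ?_⟩
    have key := mul_integral_deriv_genJacobiWeight γ hα hβ ht (P t (m + 1) * P t m)
    rw [← hLint t ht, ← hLint t ht, hLorth t ht, if_neg (by omega),
      functional_X_mul_derivative_mul (hmonic t ht) (hLorth t ht)] at key
    have hrm := hr t ht (m + 1) (by omega)
    simp only [add_tsub_cancel_right, mul_comm ((P t m).eval _), ← Polynomial.eval_mul] at hrm
    rw [hrm, mul_neg, ← mul_div_assoc, key]
    field_simp
    ring
  have ha : ∀ s < 0, a s n = (Polynomial.X * P s n).coeff n
      - (Polynomial.X * P s (n + 1)).coeff (n + 1) := by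
    intro s hs
    have hlow : b s n * (P s (n - 1)).coeff n = 0 := by
      rcases n with _ | n
      · rw [hb0 s hs, zero_mul]
      · rw [Polynomial.coeff_eq_zero_of_natDegree_lt, mul_zero]
        rw [(hmonic s hs _).2]
        omega
    rw [hrecP s hs n, Polynomial.coeff_X_mul, Polynomial.coeff_add, Polynomial.coeff_add,
      Polynomial.coeff_smul, Polynomial.coeff_smul, smul_eq_mul, smul_eq_mul,
      coeff_eq_one_of_monic (hmonic s hs n), hlow]
    ring
  obtain ⟨d, hd, hdt⟩ := hsub n
  obtain ⟨e, he, het⟩ := hsub (n + 1)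
  have hder : HasDerivAt (fun s => a s n) (d - e) t :=
    (hd.sub he).congr_of_eventuallyEq (hneg.mono ha)
  rw [hder.deriv, ha t ht]
  linarith
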